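/- Single-step monotonicity in Han's inequality: Let X = (X_1, ..., X_i) be a tuple of discrete random variables on a probability space, each taking values in a finite set, and for 1 ≤ k ≤ i let H̄^k(X) = (1 / C(i,k)) · Σ_{T ⊆ {1,...,i}, |T| = k} H(X_T). Then for every k with 1 ≤ k < i, (1/(k+1)) · H̄^{k+1}(X) ≤ (1/k) · H̄^k(X). -/

import Mathlib

open MeasureTheory Real

/-- Shannon entropy of a random variable with values in a finite type,
with the convention `0 * log 0 = 0` (automatic since `Real.log 0 = 0`). -/
noncomputable def shannonEntropy {Ω : Type*} [MeasurableSpace Ω] (μ : Measure Ω)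
    {S : Type*} [Fintype S] (X : Ω → S) : ℝ :=
  - ∑ s : S, (μ (X ⁻¹' {s})).toReal * Real.log (μ (X ⁻¹' {s})).toReal

/-- `H̄^k(X)`: the average joint entropy over all `k`-element subsets of the `i` coordinates. -/
noncomputable def avgEntropy {Ω : Type*} [MeasurableSpace Ω] (μ : Measure Ω)
    {i : ℕ} {S : Fin i → Type*} [∀ j, Fintype (S j)]
    (X : ∀ j, Ω → S j) (k : ℕ) : ℝ :=
  (1 / (i.choose k : ℝ)) *
    ∑ T ∈ Finset.powersetCard k (Finset.univ : Finset (Fin i)),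
      shannonEntropy μ (fun ω (j : {x : Fin i // x ∈ T}) => X j.1 ω)

/-- Finite three-variable submodularity. -/
lemma han_fin {A B C : Type*} [Fintype A] [Fintype B] [Fintype C] (p : A → B → C → ℝ)
    (hp : ∀ a b c, 0 ≤ p a b c) :
    (∑ a, ∑ c, (∑ b, p a b c) * log (∑ b, p a b c)) +
      (∑ b, ∑ c, (∑ a, p a b c) * log (∑ a, p a b c)) ≤
    (∑ a, ∑ b, ∑ c, p a b c * log (p a b c)) +
      ∑ c, (∑ a, ∑ b, p a b c) * log (∑ a, ∑ b, p a b c) := by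
  set u : A → C → ℝ := fun a c => ∑ b, p a b c with hu
  set v : B → C → ℝ := fun b c => ∑ a, p a b c with hv
  set w : C → ℝ := fun c => ∑ a, ∑ b, p a b c with hw
  have hpu : ∀ a b c, p a b c ≤ u a c := fun a b c =>
    Finset.single_le_sum (f := fun b => p a b c) (fun b _ => hp a b c) (Finset.mem_univ b)
  have hpv : ∀ a b c, p a b c ≤ v b c := fun a b c =>
    Finset.single_le_sum (f := fun a => p a b c) (fun a _ => hp a b c) (Finset.mem_univ a)
  have hu0 : ∀ a c, 0 ≤ u a c := fun a c => Finset.sum_nonneg fun b _ => hp a b c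
  have hv0 : ∀ b c, 0 ≤ v b c := fun b c => Finset.sum_nonneg fun a _ => hp a b c
  have huw : ∀ a c, u a c ≤ w c := fun a c =>
    Finset.single_le_sum (f := fun a => u a c) (fun a _ => hu0 a c) (Finset.mem_univ a)
  have hw0 : ∀ c, 0 ≤ w c := fun c => Finset.sum_nonneg fun a _ => hu0 a c
  have hwu : ∀ c, ∑ a, u a c = w c := fun c => rfl
  have hwv : ∀ c, ∑ b, v b c = w c := fun c => Finset.sum_comm
  have key : ∀ a b c, p a b c * log (u a c) + p a b c * log (v b c) - p a b c * log (p a b c)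
      - p a b c * log (w c) ≤ u a c * v b c / w c - p a b c := by
    intro a b c
    rcases (hp a b c).eq_or_lt with h | h
    · rw [← h]
      have : 0 ≤ u a c * v b c / w c := div_nonneg (mul_nonneg (hu0 _ _) (hv0 _ _)) (hw0 _)
      simpa using this
    · have h1 : 0 < u a c := h.trans_le (hpu a b c)
      have h2 : 0 < v b c := h.trans_le (hpv a b c)
      have h3 : 0 < w c := h1.trans_le (huw a c)
      have h4 := log_le_sub_one_of_pos (x := u a c * v b c / (p a b c * w c)) (by positivity)
      rw [log_div (by positivity) (by positivity), log_mul h1.ne' h2.ne',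
        log_mul h.ne' h3.ne'] at h4
      have h5 := mul_le_mul_of_nonneg_left h4 h.le
      have h6 : p a b c * (u a c * v b c / (p a b c * w c) - 1) = u a c * v b c / w c - p a b c := by
        field_simp
      rw [h6] at h5
      linarith
  have hsum : ∑ c, ∑ a, ∑ b, (p a b c * log (u a c) + p a b c * log (v b c)
      - p a b c * log (p a b c) - p a b c * log (w c)) ≤
      ∑ c, ∑ a, ∑ b, (u a c * v b c / w c - p a b c) :=
    Finset.sum_le_sum fun c _ => Finset.sum_le_sum fun a _ => Finset.sum_le_sum fun b _ => key a b c
  have hzero : ∑ c, ∑ a, ∑ b, (u a c * v b c / w c - p a b c) = 0 := by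
    refine Finset.sum_eq_zero fun c _ => ?_
    simp only [Finset.sum_sub_distrib]
    have : ∑ a, ∑ b, u a c * v b c / w c = w c * w c / w c := by
      simp only [← Finset.sum_div, ← Finset.mul_sum, hwv, ← Finset.sum_mul, hwu]
    rw [this, mul_self_div_self]
    exact sub_self _
  have e1 : ∑ a, ∑ c, u a c * log (u a c) = ∑ c, ∑ a, ∑ b, p a b c * log (u a c) := by
    rw [Finset.sum_comm]
    simp only [← Finset.sum_mul, hu]
  have e2 : ∑ b, ∑ c, v b c * log (v b c) = ∑ c, ∑ a, ∑ b, p a b c * log (v b c) := by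
    rw [Finset.sum_comm]
    refine Finset.sum_congr rfl fun c _ => ?_
    rw [Finset.sum_comm (γ := A)]
    simp only [← Finset.sum_mul, hv]
  have e3 : ∑ c, w c * log (w c) = ∑ c, ∑ a, ∑ b, p a b c * log (w c) := by
    simp only [← Finset.sum_mul, hw]
  have e4 : ∑ a, ∑ b, ∑ c, p a b c * log (p a b c) = ∑ c, ∑ a, ∑ b, p a b c * log (p a b c) := by
    rw [Finset.sum_comm (γ := C)]
    refine Finset.sum_congr rfl fun a _ => ?_
    rw [Finset.sum_comm]
  simp only [Finset.sum_sub_distrib, Finset.sum_add_distrib] at hsum hzero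
  change (∑ a, ∑ c, u a c * log (u a c)) + (∑ b, ∑ c, v b c * log (v b c)) ≤
    _ + ∑ c, w c * log (w c)
  rw [e1, e2, e3, e4]
  linarith

/-- Entropy depends only on the partition induced by the variable. -/
lemma han_congr {Ω : Type*} [MeasurableSpace Ω] (μ : Measure Ω)
    {S S' : Type*} [Fintype S] [Fintype S'] (X : Ω → S) (Y : Ω → S')
    (h : ∀ ω ω', X ω = X ω' ↔ Y ω = Y ω') : shannonEntropy μ X = shannonEntropy μ Y := by
  classical
  unfold shannonEntropy
  congr 1
  have hne : ∀ {T : Type _} (Z : Ω → T) (s : T),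
      (μ (Z ⁻¹' {s})).toReal * Real.log (μ (Z ⁻¹' {s})).toReal ≠ 0 → ∃ ω, Z ω = s := by
    intro T Z s hs
    by_contra hc
    apply hs
    have : Z ⁻¹' {s} = ∅ := by
      ext ω; simp; exact fun h => hc ⟨ω, h⟩
    simp [this]
  have hne' : ∀ {T : Type _} (Z : Ω → T) (s : T),
      (μ (Z ⁻¹' {s})).toReal * Real.log (μ (Z ⁻¹' {s})).toReal ≠ 0 → ∃ ω, Z ω = s := by
    intro T Z s hs
    by_contra hc
    apply hs
    have : Z ⁻¹' {s} = ∅ := by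
      ext ω; simp; exact fun h => hc ⟨ω, h⟩
    simp [this]
  have hfib : ∀ ω, X ⁻¹' {X ω} = Y ⁻¹' {Y ω} := by
    intro ω; ext ω'; simp [h]
  refine Finset.sum_bij_ne_zero (fun s _ hs => Y (hne X s hs).choose) ?_ ?_ ?_ ?_
  · intros; exact Finset.mem_univ _
  · intro a _ ha b _ hb hab
    have := (h _ _).2 hab
    rwa [(hne X a ha).choose_spec, (hne X b hb).choose_spec] at this
  · intro b _ hb
    obtain ⟨ω, rfl⟩ := hne' Y b hb
    have hx : (μ (X ⁻¹' {X ω})).toReal * Real.log (μ (X ⁻¹' {X ω})).toReal ≠ 0 := by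
      rwa [hfib]
    exact ⟨X ω, Finset.mem_univ _, hx, (h _ _).1 (hne X _ hx).choose_spec⟩
  · intro a _ ha
    rw [← hfib, (hne X a ha).choose_spec]

lemma han_marg {Ω : Type*} [MeasurableSpace Ω] (μ : Measure Ω) [IsProbabilityMeasure μ]
    {A : Type*} [Fintype A] (X : Ω → A) (hX : ∀ a, MeasurableSet (X ⁻¹' {a}))
    (s : Set Ω) (hs : MeasurableSet s) :
    (μ s).toReal = ∑ a, (μ (X ⁻¹' {a} ∩ s)).toReal := by
  rw [← ENNReal.toReal_sum (fun a _ => measure_ne_top _ _)]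
  congr 1
  have : s = ⋃ a ∈ (Finset.univ : Finset A), X ⁻¹' {a} ∩ s := by
    ext ω; simp
  conv_lhs => rw [this]
  refine measure_biUnion_finset ?_ (fun a _ => (hX a).inter hs)
  intro a _ b _ hab
  refine Set.disjoint_left.2 fun ω h1 h2 => hab ?_
  exact h1.1.symm.trans h2.1

/-- Submodularity of Shannon entropy. -/
lemma han_submod {Ω : Type*} [MeasurableSpace Ω] (μ : Measure Ω) [IsProbabilityMeasure μ]
    {A B C : Type*} [Fintype A] [Fintype B] [Fintype C] (X : Ω → A) (Y : Ω → B) (Z : Ω → C)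
    (hX : ∀ a, MeasurableSet (X ⁻¹' {a})) (hY : ∀ a, MeasurableSet (Y ⁻¹' {a}))
    (hZ : ∀ a, MeasurableSet (Z ⁻¹' {a})) :
    shannonEntropy μ (fun ω => (X ω, Y ω, Z ω)) + shannonEntropy μ Z ≤
      shannonEntropy μ (fun ω => (X ω, Z ω)) + shannonEntropy μ (fun ω => (Y ω, Z ω)) := by
  have h := han_fin (fun a b c => (μ (X ⁻¹' {a} ∩ (Y ⁻¹' {b} ∩ Z ⁻¹' {c}))).toReal)
    (fun _ _ _ => ENNReal.toReal_nonneg)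
  have h1 : ∀ b c, ∑ a, (μ (X ⁻¹' {a} ∩ (Y ⁻¹' {b} ∩ Z ⁻¹' {c}))).toReal =
      (μ (Y ⁻¹' {b} ∩ Z ⁻¹' {c})).toReal := fun b c =>
    (han_marg μ X hX _ ((hY b).inter (hZ c))).symm
  have h2 : ∀ a c, ∑ b, (μ (X ⁻¹' {a} ∩ (Y ⁻¹' {b} ∩ Z ⁻¹' {c}))).toReal =
      (μ (X ⁻¹' {a} ∩ Z ⁻¹' {c})).toReal := fun a c => by
    rw [han_marg μ Y hY _ ((hX a).inter (hZ c))]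
    simp only [Set.inter_left_comm]
  have h3 : ∀ c, ∑ a, (μ (X ⁻¹' {a} ∩ Z ⁻¹' {c})).toReal = (μ (Z ⁻¹' {c})).toReal := fun c =>
    (han_marg μ X hX _ (hZ c)).symm
  simp only [h1, h2, h3] at h
  unfold shannonEntropy
  simp only [Fintype.sum_prod_type, ← Set.singleton_prod_singleton, Set.mk_preimage_prod]
  linarith

/-- Submodular set functions vanishing at the empty set: the local Han inequality. -/
lemma han_local {ι : Type*} [DecidableEq ι] (F : Finset ι → ℝ) (h0 : F ∅ = 0)
    (hF : ∀ A B C, F (A ∪ B ∪ C) + F C ≤ F (A ∪ C) + F (B ∪ C)) (T : Finset ι) :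
    ∑ j ∈ T, (F T - F (T.erase j)) ≤ F T := by
  have : ∀ A : Finset ι, A ⊆ T → ∑ j ∈ A, (F T - F (T.erase j)) ≤ F T - F (T \ A) := by
    intro A
    induction A using Finset.induction_on with
    | empty => simp
    | insert a A ha ih =>
      intro hA
      rw [Finset.sum_insert ha]
      have haT : a ∈ T := hA (Finset.mem_insert_self _ _)
      have hAT : A ⊆ T := (Finset.subset_insert _ _).trans hA
      have h1 := ih hAT
      have h2 := hF A {a} (T \ insert a A)
      have e1 : A ∪ {a} ∪ (T \ insert a A) = T := by
        ext x; have := @hAT x; simp; by_cases x = a <;> grind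
      have e2 : A ∪ (T \ insert a A) = T.erase a := by
        ext x; have := @hAT x; simp; by_cases x = a <;> grind
      have e3 : {a} ∪ (T \ insert a A) = T \ A := by
        ext x; have := @hAT x; simp; by_cases x = a <;> grind
      rw [e1, e2, e3] at h2
      linarith
  simpa [h0] using this T (Finset.Subset.refl _)

lemma han_count {i : ℕ} (F : Finset (Fin i) → ℝ) (k : ℕ) (hki : k < i) :
    ∑ T ∈ Finset.powersetCard (k + 1) (Finset.univ : Finset (Fin i)), ∑ j ∈ T, F (T.erase j) =
      ((i : ℝ) - k) * ∑ U ∈ Finset.powersetCard k (Finset.univ : Finset (Fin i)), F U := by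
  have h1 : ∀ U ∈ Finset.powersetCard k (Finset.univ : Finset (Fin i)),
      ((i : ℝ) - k) * F U = ∑ j ∈ Uᶜ, F U := by
    intro U hU
    rw [Finset.sum_const, Finset.card_compl, (Finset.mem_powersetCard.1 hU).2, Fintype.card_fin,
      nsmul_eq_mul, Nat.cast_sub hki.le]
  rw [Finset.mul_sum, Finset.sum_congr rfl h1, Finset.sum_sigma', Finset.sum_sigma']
  refine Finset.sum_bij' (fun x _ => ⟨x.1.erase x.2, x.2⟩) (fun x _ => ⟨insert x.2 x.1, x.2⟩)
    ?_ ?_ ?_ ?_ ?_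
  · rintro ⟨T, j⟩ h
    simp [Finset.mem_powersetCard] at h ⊢
    rw [Finset.card_erase_of_mem h.2]; omega
  · rintro ⟨T, j⟩ h
    simp [Finset.mem_powersetCard] at h ⊢
    rw [Finset.card_insert_of_notMem h.2]; omega
  · rintro ⟨T, j⟩ h
    simp at h
    simp [Finset.insert_erase h.2]
  · rintro ⟨T, j⟩ h
    simp at h
    simp [Finset.erase_insert h.2]
  · intros; rfl

/-- Single-step monotonicity in Han's inequality:
`(1/(k+1)) * H̄^{k+1}(X) ≤ (1/k) * H̄^k(X)` for `1 ≤ k < i`. -/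
theorem hans_inequality_single_step
    {Ω : Type*} [MeasurableSpace Ω] (μ : Measure Ω) [IsProbabilityMeasure μ]
    {i : ℕ} {S : Fin i → Type*} [∀ j, Fintype (S j)]
    (X : ∀ j, Ω → S j) (hX : ∀ j s, MeasurableSet (X j ⁻¹' {s}))
    {k : ℕ} (hk : 1 ≤ k) (hki : k < i) :
    (1 / ((k : ℝ) + 1)) * avgEntropy μ X (k + 1) ≤ (1 / (k : ℝ)) * avgEntropy μ X k := by
  set F : Finset (Fin i) → ℝ := fun T =>
    shannonEntropy μ (fun ω (j : {x : Fin i // x ∈ T}) => X j.1 ω) with hFdef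
  have hmeas : ∀ (T : Finset (Fin i)) (s : ∀ j : {x : Fin i // x ∈ T}, S j.1),
      MeasurableSet ((fun ω (j : {x : Fin i // x ∈ T}) => X j.1 ω) ⁻¹' {s}) := by
    intro T s
    have : (fun ω (j : {x : Fin i // x ∈ T}) => X j.1 ω) ⁻¹' {s} =
        ⋂ j : {x : Fin i // x ∈ T}, X j.1 ⁻¹' {s j} := by
      ext ω; simp [funext_iff]
    rw [this]
    exact MeasurableSet.iInter fun j => hX _ _
  have h0 : F ∅ = 0 := by
    have : ∀ s : (∀ j : {x : Fin i // x ∈ (∅ : Finset (Fin i))}, S j.1),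
        (fun ω (j : {x : Fin i // x ∈ (∅ : Finset (Fin i))}) => X j.1 ω) ⁻¹' {s} = Set.univ := by
      intro s
      ext ω
      simp [funext_iff]
    simp only [hFdef, shannonEntropy, this]
    simp
  have hF : ∀ A B C, F (A ∪ B ∪ C) + F C ≤ F (A ∪ C) + F (B ∪ C) := by
    intro A B C
    have h := han_submod μ _ _ _ (hmeas A) (hmeas B) (hmeas C)
    have e1 : F (A ∪ B ∪ C) = _ := han_congr μ _ (fun ω =>
      ((fun j : {x : Fin i // x ∈ A} => X j.1 ω), (fun j : {x : Fin i // x ∈ B} => X j.1 ω),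
        (fun j : {x : Fin i // x ∈ C} => X j.1 ω))) (by
          intro ω ω'; simp only [funext_iff, Prod.mk.injEq, Subtype.forall, Finset.mem_union]
          grind)
    have e2 : F (A ∪ C) = _ := han_congr μ _ (fun ω =>
      ((fun j : {x : Fin i // x ∈ A} => X j.1 ω),
        (fun j : {x : Fin i // x ∈ C} => X j.1 ω))) (by
          intro ω ω'; simp only [funext_iff, Prod.mk.injEq, Subtype.forall, Finset.mem_union]
          grind)
    have e3 : F (B ∪ C) = _ := han_congr μ _ (fun ω =>
      ((fun j : {x : Fin i // x ∈ B} => X j.1 ω),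
        (fun j : {x : Fin i // x ∈ C} => X j.1 ω))) (by
          intro ω ω'; simp only [funext_iff, Prod.mk.injEq, Subtype.forall, Finset.mem_union]
          grind)
    rw [e1, e2, e3]
    exact h
  have hsum : ∑ T ∈ Finset.powersetCard (k + 1) (Finset.univ : Finset (Fin i)), (k : ℝ) * F T ≤
      ∑ T ∈ Finset.powersetCard (k + 1) (Finset.univ : Finset (Fin i)),
        ∑ j ∈ T, F (T.erase j) := by
    refine Finset.sum_le_sum fun T hT => ?_
    have h := han_local F h0 hF T
    rw [Finset.sum_sub_distrib, Finset.sum_const, (Finset.mem_powersetCard.1 hT).2,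
      nsmul_eq_mul] at h
    push_cast at h
    linarith
  rw [han_count F k hki, ← Finset.mul_sum] at hsum
  unfold avgEntropy
  change 1 / ((k : ℝ) + 1) * (1 / (i.choose (k + 1) : ℝ) *
    ∑ T ∈ Finset.powersetCard (k + 1) (Finset.univ : Finset (Fin i)), F T) ≤
    1 / (k : ℝ) * (1 / (i.choose k : ℝ) *
    ∑ T ∈ Finset.powersetCard k (Finset.univ : Finset (Fin i)), F T)
  generalize (∑ T ∈ Finset.powersetCard (k + 1) (Finset.univ : Finset (Fin i)), F T) = P at *
  generalize (∑ T ∈ Finset.powersetCard k (Finset.univ : Finset (Fin i)), F T) = Q at *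
  have hc : (i.choose (k + 1) : ℝ) * ((k : ℝ) + 1) = i.choose k * ((i : ℝ) - k) := by
    have := Nat.choose_succ_right_eq i k
    rw [← Nat.cast_sub hki.le]
    exact_mod_cast this
  have hk0 : (0 : ℝ) < k := by exact_mod_cast hk
  have hik : (0 : ℝ) < (i : ℝ) - k := by
    have : (k : ℝ) < i := by exact_mod_cast hki
    linarith
  have hc0 : (0 : ℝ) < i.choose k := by exact_mod_cast Nat.choose_pos hki.le
  have e1 : 1 / ((k : ℝ) + 1) * (1 / (i.choose (k + 1) : ℝ) * P) =
      P / ((i.choose k : ℝ) * ((i : ℝ) - k)) := by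
    rw [← hc, div_eq_mul_inv P, mul_inv]; ring
  have e2 : 1 / (k : ℝ) * (1 / (i.choose k : ℝ) * Q) = Q / ((i.choose k : ℝ) * k) := by
    ring
  rw [e1, e2, div_le_div_iff₀ (by positivity) (by positivity)]
  nlinarith [mul_le_mul_of_nonneg_left hsum hc0.le]
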